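/- Let o₁(n) be the number of partitions of n whose minimal excludant is ≡ 1 (mod 4) and o₃(n) the number whose minimal excludant is ≡ 3 (mod 4). Then o₁(n) = o₃(n) when n is odd, and o₁(n) = o₃(n) + q(n/2) when n is even, where q(m) is the number of partitions of m into distinct parts. -/

import Mathlib

open Finset

/-- The minimal excludant of a partition: the least positive integer not a part. -/
noncomputable def mex {n : ℕ} (π : Nat.Partition n) : ℕ :=
  sInf {m : ℕ | 0 < m ∧ m ∉ π.parts}

/-- Number of partitions of `n` with minimal excludant `m`. -/
noncomputable def pmex (m n : ℕ) : ℕ :=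
  ((Finset.univ : Finset (Nat.Partition n)).filter (fun π => mex π = m)).card

/-- The partition function, extended by `0` on negative integers. -/
noncomputable def pz (k : ℤ) : ℕ := if 0 ≤ k then Fintype.card (Nat.Partition k.toNat) else 0

/-- Number of partitions of `m` into distinct parts. -/
def qdist (m : ℕ) : ℕ := (Nat.Partition.distincts m).card

/-- A two-colored distinct-parts partition of `n`: a set of distinct (part, color)
pairs with positive parts summing to `n`. -/
def IsTCD (n : ℕ) (s : Finset (ℕ × Fin 2)) : Prop :=
  (∀ p ∈ s, 0 < p.1) ∧ ∑ p ∈ s, p.1 = n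

noncomputable def D2 (n : ℕ) : ℕ := Set.ncard {s : Finset (ℕ × Fin 2) | IsTCD n s}
noncomputable def D2e (n : ℕ) : ℕ :=
  Set.ncard {s : Finset (ℕ × Fin 2) | IsTCD n s ∧ Even s.card}
noncomputable def D2o (n : ℕ) : ℕ :=
  Set.ncard {s : Finset (ℕ × Fin 2) | IsTCD n s ∧ Odd s.card}

/-- triangular numbers -/
def triN : ℕ → ℕ
  | 0 => 0
  | s + 1 => triN s + (s + 1)

/-- Shanks' summand -/
def shW {R : Type*} [CommRing R] (x : R) (n s : ℕ) : R :=
  (∏ k ∈ Finset.Ico s n, (1 - x ^ (2 * k + 2))) *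
    (∏ k ∈ Finset.range s, (1 - x ^ (2 * k + 1))) * x ^ (s * (2 * n + 1))

theorem triN_two_mul (n : ℕ) : triN (2 * n) = n * (2 * n + 1) := by
  induction n with
  | zero => rfl
  | succ n ih =>
    show triN (2 * n) + (2 * n + 1) + (2 * n + 1 + 1) = _
    rw [ih]; ring

theorem shW_succ {R : Type*} [CommRing R] (x : R) (n s : ℕ) (h : s ≤ n) :
    shW x (n + 1) s = (1 - x ^ (2 * n + 2)) * x ^ (2 * s) * shW x n s := by
  unfold shW
  rw [Finset.prod_Ico_succ_top h]
  ring

theorem shW_next {R : Type*} [CommRing R] (x : R) (n s : ℕ) (h : s < n) :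
    shW x n (s + 1) * (1 - x ^ (2 * s + 2)) =
      shW x n s * ((1 - x ^ (2 * s + 1)) * x ^ (2 * n + 1)) := by
  unfold shW
  rw [Finset.prod_eq_prod_Ico_succ_bot h, Finset.prod_range_succ]
  ring

theorem shanks_tel {R : Type*} [CommRing R] (x : R) (n m : ℕ) (h : m ≤ n) :
    ∑ s ∈ Finset.range m, shW x (n + 1) s - (1 - x ^ (2 * n + 1)) * ∑ s ∈ Finset.range m, shW x n s
      = shW x n m * (1 - x ^ (2 * m)) := by
  induction m with
  | zero => simp
  | succ m ih =>
    have h1 := ih (by omega)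
    have h2 := shW_succ x n m (by omega)
    have h3 := shW_next x n m (by omega)
    rw [Finset.sum_range_succ, Finset.sum_range_succ]
    rw [show 2 * (m + 1) = 2 * m + 2 by ring, h3, h2]
    linear_combination h1

theorem shanks {R : Type*} [CommRing R] (x : R) (n : ℕ) :
    ∑ s ∈ Finset.range n, shW x n s =
      (∏ k ∈ Finset.range n, (1 - x ^ (2 * k + 1))) * ∑ s ∈ Finset.range (2 * n), x ^ triN s := by
  induction n with
  | zero => simp
  | succ n ih =>
    have h1 := shanks_tel x n n le_rfl
    have h2 := shW_succ x n n le_rfl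
    have h3 : shW x n n = (∏ k ∈ Finset.range n, (1 - x ^ (2 * k + 1))) * x ^ triN (2 * n) := by
      simp [shW, triN_two_mul]
    rw [Finset.sum_range_succ, h2, show 2 * (n + 1) = 2 * n + 1 + 1 by ring,
      Finset.sum_range_succ _ (2 * n + 1), Finset.sum_range_succ _ (2 * n),
      Finset.prod_range_succ]
    rw [ih, h3] at h1
    rw [h3, show triN (2 * n + 1) = triN (2 * n) + (2 * n + 1) from rfl,
      pow_add x (triN (2 * n))]
    generalize ∏ k ∈ Finset.range n, (1 - x ^ (2 * k + 1)) = A at *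
    linear_combination h1

theorem shanks_mod {R : Type*} [CommRing R] (x : R) (n : ℕ) (hn : 0 < n) :
    x ^ (2 * n + 1) ∣ (∏ k ∈ Finset.range n, (1 - x ^ (2 * k + 1))) *
      ∑ s ∈ Finset.range (2 * n), x ^ triN s - ∏ k ∈ Finset.range n, (1 - x ^ (2 * k + 2)) := by
  rw [← shanks]
  obtain ⟨m, rfl⟩ : ∃ m, n = m + 1 := ⟨n - 1, by omega⟩
  rw [Finset.sum_range_succ']
  have : shW x (m + 1) 0 = ∏ k ∈ Finset.range (m + 1), (1 - x ^ (2 * k + 2)) := by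
    simp [shW]
  rw [this, add_sub_cancel_right]
  apply Finset.dvd_sum
  intro i _
  unfold shW
  apply Dvd.dvd.mul_left
  apply pow_dvd_pow
  nlinarith

open PowerSeries in
theorem psi_mod (n : ℕ) (hn : 0 < n) :
    (X : ℤ⟦X⟧) ^ (2 * n + 1) ∣ (∏ k ∈ Finset.range n, (1 - X ^ (4 * k + 2))) *
      (∑ s ∈ Finset.range (2 * n), (-X : ℤ⟦X⟧) ^ triN s)
        - ∏ k ∈ Finset.range (2 * n), (1 - X ^ (k + 1)) := by
  have h := shanks_mod (-X : ℤ⟦X⟧) n hn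
  have hd : (X : ℤ⟦X⟧) ^ (2 * n + 1) ∣ (-X : ℤ⟦X⟧) ^ (2 * n + 1) := by
    rw [Odd.neg_pow (by simp)]; simp
  have h' := (hd.trans h).mul_left (∏ k ∈ Finset.range n, (1 - (X : ℤ⟦X⟧) ^ (2 * k + 1)))
  convert h' using 1
  have e1 : ∏ k ∈ Finset.range (2 * n), (1 - (X : ℤ⟦X⟧) ^ (k + 1)) =
      (∏ k ∈ Finset.range n, (1 - (X : ℤ⟦X⟧) ^ (2 * k + 1))) *
        ∏ k ∈ Finset.range n, (1 - (-X : ℤ⟦X⟧) ^ (2 * k + 2)) := by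
    clear * -
    induction n with
    | zero => simp
    | succ n ih =>
      rw [show 2 * (n + 1) = 2 * n + 1 + 1 by ring, Finset.prod_range_succ, Finset.prod_range_succ,
        ih, Finset.prod_range_succ, Finset.prod_range_succ,
        Even.neg_pow (n := 2 * n + 2) ⟨n + 1, by ring⟩]
      ring
  have e2 : ∏ k ∈ Finset.range n, (1 - (X : ℤ⟦X⟧) ^ (4 * k + 2)) =
      (∏ k ∈ Finset.range n, (1 - (X : ℤ⟦X⟧) ^ (2 * k + 1))) *
        ∏ k ∈ Finset.range n, (1 - (-X : ℤ⟦X⟧) ^ (2 * k + 1)) := by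
    rw [← Finset.prod_mul_distrib]
    refine Finset.prod_congr rfl fun k _ => ?_
    rw [Odd.neg_pow (n := 2 * k + 1) (by simp)]
    ring
  rw [e1, e2]; ring

open Nat.Partition in
theorem restr_rec (p : ℕ → Prop) [DecidablePred p] (a n : ℕ) (ha : 0 < a) (hpa : p a) :
    (restricted n p).card = (restricted n (fun i => p i ∧ i ≠ a)).card +
      if a ≤ n then (restricted (n - a) p).card else 0 := by
  have h0 : (restricted n p).card =
      ((restricted n p).filter (fun π => a ∉ π.parts)).card +
      ((restricted n p).filter (fun π => ¬ a ∉ π.parts)).card :=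
    (Finset.card_filter_add_card_filter_not _).symm
  rw [h0]
  congr 1
  · congr 1
    ext π
    simp only [restricted, Finset.mem_filter, Finset.mem_univ, true_and]
    constructor
    · rintro ⟨h1, h2⟩ i hi
      exact ⟨h1 i hi, fun h => h2 (h ▸ hi)⟩
    · intro h
      exact ⟨fun i hi => (h i hi).1, fun hi => (h a hi).2 rfl⟩
  · split_ifs with han
    · symm
      refine Finset.card_bij
        (fun π _ => ((partitionWithPartEquiv ha han).symm π).1) ?_ ?_ ?_
      · intro π hπ
        simp only [restricted, Finset.mem_filter, Finset.mem_univ, true_and] at hπ ⊢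
        rw [partitionWithPartEquiv_symm_apply_parts]
        simp
        exact ⟨hpa, hπ⟩
      · intro π _ σ _ h
        exact (partitionWithPartEquiv ha han).symm.injective (Subtype.ext h)
      · intro π hπ
        simp only [restricted, Finset.mem_filter, Finset.mem_univ, true_and, not_not] at hπ
        refine ⟨partitionWithPartEquiv ha han ⟨π, hπ.2⟩, ?_, by simp⟩
        simp only [restricted, Finset.mem_filter, Finset.mem_univ, true_and,
          partitionWithPartEquiv_apply_parts]
        exact fun i hi => hπ.1 i (Multiset.mem_of_mem_erase hi)
    · rw [Finset.card_eq_zero, Finset.filter_eq_empty_iff]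
      intro π _ h
      exact han (le_of_mem_parts (not_not.1 h))

open PowerSeries in
/-- generating function of restricted partitions -/
noncomputable def gfR (p : ℕ → Prop) [DecidablePred p] : ℤ⟦X⟧ :=
  PowerSeries.mk fun n => ((Nat.Partition.restricted n p).card : ℤ)

open PowerSeries in
theorem gfR_mul (p : ℕ → Prop) [DecidablePred p] (a : ℕ) (ha : 0 < a) (hpa : p a) :
    gfR p * (1 - X ^ a) = gfR (fun i => p i ∧ i ≠ a) := by
  ext n
  rw [mul_sub, mul_one, map_sub, coeff_mul_X_pow']
  simp only [gfR, coeff_mk]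
  rw [restr_rec p a n ha hpa]
  split_ifs <;> push_cast <;> ring

theorem gfR_congr (p q : ℕ → Prop) [DecidablePred p] [DecidablePred q] (h : ∀ i, p i ↔ q i) :
    gfR p = gfR q := by
  have : p = q := funext fun i => propext (h i)
  subst this
  congr!

open PowerSeries in
theorem gfR_prod (p : ℕ → Prop) [DecidablePred p] (f : ℕ → ℕ) (hf : StrictMono f)
    (hf0 : 0 < f 0) (hp : ∀ k, p (f k)) (M : ℕ) :
    gfR p * ∏ k ∈ Finset.range M, (1 - X ^ (f k)) =
      gfR (fun i => p i ∧ ∀ k < M, i ≠ f k) := by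
  induction M with
  | zero => simp; exact gfR_congr _ _ (by simp)
  | succ M ih =>
    rw [Finset.prod_range_succ, ← mul_assoc, ih, gfR_mul]
    · apply gfR_congr
      intro i
      simp only [Nat.lt_succ_iff_lt_or_eq]
      constructor
      · rintro ⟨⟨h1, h2⟩, h3⟩
        refine ⟨h1, ?_⟩
        rintro k (hk | rfl)
        · exact h2 k hk
        · exact h3
      · rintro ⟨h1, h2⟩
        exact ⟨⟨h1, fun k hk => h2 k (Or.inl hk)⟩, h2 M (Or.inr rfl)⟩
    · exact hf0.trans_le (hf.monotone (Nat.zero_le _))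
    · exact ⟨hp M, fun k hk h => by have := hf hk; omega⟩

open PowerSeries in
theorem gfR_big (p : ℕ → Prop) [DecidablePred p] (L : ℕ) (h : ∀ i, 0 < i → p i → L ≤ i) :
    (X : ℤ⟦X⟧) ^ L ∣ gfR p - 1 := by
  rw [X_pow_dvd_iff]
  intro m hm
  rw [map_sub, gfR, coeff_mk, coeff_one]
  split_ifs with h0
  · subst h0
    have : Nat.Partition.restricted 0 p = Finset.univ := by
      ext π; simp [Nat.Partition.restricted]
    rw [this]; simp
  · have : Nat.Partition.restricted m p = ∅ := by
      rw [Nat.Partition.restricted, Finset.filter_eq_empty_iff]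
      intro π _ hπ
      obtain ⟨i, hi⟩ : ∃ i, i ∈ π.parts := by
        apply Multiset.exists_mem_of_ne_zero
        intro h
        have := π.parts_sum
        rw [h] at this
        simp at this; omega
      have := h i (π.parts_pos hi) (hπ i hi)
      have := Nat.Partition.le_of_mem_parts hi
      omega
    rw [this]; simp

open PowerSeries in
theorem key_mod (n : ℕ) (hn : 0 < n) :
    (X : ℤ⟦X⟧) ^ (2 * n + 1) ∣
      gfR (fun _ => True) * (∑ s ∈ Finset.range (2 * n), (-X : ℤ⟦X⟧) ^ triN s)
        - gfR (fun i => i % 4 = 2) := by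
  have hA : (X : ℤ⟦X⟧) ^ (2 * n + 1) ∣
      gfR (fun _ => True) * ∏ k ∈ Finset.range (2 * n), (1 - X ^ (k + 1)) - 1 := by
    rw [gfR_prod (fun _ => True) (fun k => k + 1) (fun a b h => by simpa using h) (by simp)
      (by simp)]
    apply gfR_big
    rintro i hi ⟨-, h⟩
    by_contra hc
    exact h (i - 1) (by omega) (by omega)
  have hB : (X : ℤ⟦X⟧) ^ (2 * n + 1) ∣
      gfR (fun i => i % 4 = 2) * ∏ k ∈ Finset.range n, (1 - X ^ (4 * k + 2)) - 1 := by
    rw [gfR_prod (fun i => i % 4 = 2) (fun k => 4 * k + 2)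
      (fun a b h => by show 4 * a + 2 < 4 * b + 2; omega) (by simp)
      (fun k => by omega)]
    apply gfR_big
    rintro i hi ⟨h0, h⟩
    by_contra hc
    exact h (i / 4) (by omega) (by omega)
  obtain ⟨a, ha⟩ := hA
  obtain ⟨b, hb⟩ := hB
  obtain ⟨c, hc⟩ := psi_mod n hn
  set P := gfR (fun _ => True)
  set R := gfR (fun i => i % 4 = 2)
  set S := ∑ s ∈ Finset.range (2 * n), (-X : ℤ⟦X⟧) ^ triN s
  refine ⟨R * a + P * R * c - P * S * b, ?_⟩
  linear_combination R * ha + P * R * hc - P * S * hb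

/-- number of partitions containing `1..k` -/
theorem card_contains (k n : ℕ) :
    ((Finset.univ : Finset (Nat.Partition n)).filter
      (fun π => ∀ i, i ≤ k → 0 < i → i ∈ π.parts)).card =
      if triN k ≤ n then (Nat.Partition.restricted (n - triN k) (fun _ => True)).card else 0 := by
  induction k generalizing n with
  | zero =>
    have : ∀ π : Nat.Partition n, ∀ i, i ≤ 0 → 0 < i → i ∈ π.parts := fun _ i h h' => by omega
    simp [triN, Nat.Partition.restricted]
    rfl
  | succ k ih =>
    by_cases han : k + 1 ≤ n
    · have e : ((Finset.univ : Finset (Nat.Partition n)).filter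
          (fun π => ∀ i, i ≤ k + 1 → 0 < i → i ∈ π.parts)).card =
          ((Finset.univ : Finset (Nat.Partition (n - (k + 1)))).filter
          (fun π => ∀ i, i ≤ k → 0 < i → i ∈ π.parts)).card := by
        symm
        have hk : 1 ≤ k + 1 := by omega
        refine Finset.card_bij
          (fun π _ => ((Nat.Partition.partitionWithPartEquiv hk han).symm π).1) ?_ ?_ ?_
        · intro π hπ
          simp only [Finset.mem_filter, Finset.mem_univ, true_and] at hπ ⊢
          rw [Nat.Partition.partitionWithPartEquiv_symm_apply_parts]
          intro i h2 h1
          rw [Multiset.mem_cons]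
          by_cases h : i = k + 1
          · exact Or.inl h
          · exact Or.inr (hπ i (by omega) h1)
        · intro π _ σ _ h
          exact (Nat.Partition.partitionWithPartEquiv hk han).symm.injective (Subtype.ext h)
        · intro π hπ
          simp only [Finset.mem_filter, Finset.mem_univ, true_and] at hπ
          refine ⟨Nat.Partition.partitionWithPartEquiv hk han ⟨π, hπ _ le_rfl hk⟩, ?_, by simp⟩
          simp only [Finset.mem_filter, Finset.mem_univ, true_and,
            Nat.Partition.partitionWithPartEquiv_apply_parts]
          intro i h2 h1
          rw [Multiset.mem_erase_of_ne (by omega)]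
          exact hπ i (by omega) h1
      rw [e, ih]
      have e2 : triN (k + 1) = triN k + (k + 1) := rfl
      rw [e2, show n - (k + 1) - triN k = n - (triN k + (k + 1)) by omega]
      congr 1
      simp only [eq_iff_iff]
      omega
    · rw [if_neg (by simp only [triN]; omega), Finset.card_eq_zero, Finset.filter_eq_empty_iff]
      intro π _ h
      exact han (Nat.Partition.le_of_mem_parts (h (k + 1) le_rfl (by omega)))

theorem mex_spec {n : ℕ} (π : Nat.Partition n) : 0 < mex π ∧ mex π ∉ π.parts := by
  have : {m : ℕ | 0 < m ∧ m ∉ π.parts}.Nonempty :=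
    ⟨n + 1, by simp, fun h => by have := Nat.Partition.le_of_mem_parts h; omega⟩
  exact Nat.sInf_mem this

theorem mex_le {n : ℕ} (π : Nat.Partition n) (m : ℕ) (h : 0 < m) (h' : m ∉ π.parts) :
    mex π ≤ m := Nat.sInf_le ⟨h, h'⟩

theorem lt_mex_iff {n : ℕ} (π : Nat.Partition n) (k : ℕ) :
    (∀ i, i ≤ k → 0 < i → i ∈ π.parts) ↔ k < mex π := by
  constructor
  · intro h
    by_contra hc
    exact (mex_spec π).2 (h _ (by omega) (mex_spec π).1)
  · intro h i h2 h1
    by_contra hc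
    have := mex_le π i h1 hc
    omega

theorem sum_sign (m : ℕ) : ∑ k ∈ Finset.range m, (-1 : ℤ) ^ triN k =
    (if m % 4 = 1 then 1 else 0) - (if m % 4 = 3 then 1 else 0) := by
  have h4 : ∀ j, (-1 : ℤ) ^ triN (4 * j) = 1 := by
    intro j
    rw [show 4 * j = 2 * (2 * j) by ring, triN_two_mul]
    exact Even.neg_one_pow ⟨j * (2 * (2 * j) + 1), by ring⟩
  have h1 : ∀ j, (-1 : ℤ) ^ triN (4 * j + 1) = -1 := by
    intro j
    simp only [triN, pow_add, h4]
    simp [pow_mul]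
  have h2 : ∀ j, (-1 : ℤ) ^ triN (4 * j + 2) = -1 := by
    intro j
    rw [triN, pow_add, h1]
    simp [pow_add, pow_mul]
  have h3 : ∀ j, (-1 : ℤ) ^ triN (4 * j + 3) = 1 := by
    intro j
    rw [triN, pow_add, h2]
    simp [pow_add, pow_mul]
  induction m with
  | zero => simp
  | succ m ih =>
    rw [Finset.sum_range_succ, ih]
    obtain ⟨j, hj⟩ : ∃ j, j = m / 4 := ⟨_, rfl⟩
    have : m = 4 * j ∨ m = 4 * j + 1 ∨ m = 4 * j + 2 ∨ m = 4 * j + 3 := by omega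
    rcases this with rfl | rfl | rfl | rfl
    · rw [h4]; norm_num [Nat.add_mod]
    · rw [h1]; norm_num [Nat.add_mod]
    · rw [h2]; norm_num [Nat.add_mod]
    · rw [h3]; norm_num [Nat.add_mod]

open PowerSeries in
theorem o1_sub_o3 (n : ℕ) :
    ((Finset.univ.filter (fun π : Nat.Partition n => mex π % 4 = 1)).card : ℤ) -
        (Finset.univ.filter (fun π : Nat.Partition n => mex π % 4 = 3)).card =
      ((Nat.Partition.restricted n (fun i => i % 4 = 2)).card : ℤ) := by
  have key := key_mod (n + 1) (by omega)
  rw [X_pow_dvd_iff] at key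
  have k2 := key n (by omega)
  rw [map_sub, sub_eq_zero] at k2
  have k3 : coeff n (gfR (fun i => i % 4 = 2)) =
    ((Nat.Partition.restricted n (fun i => i % 4 = 2)).card : ℤ) := by simp [gfR]
  rw [← k3, ← k2, Finset.mul_sum, map_sum]
  have k4 : ∀ s, coeff n (gfR (fun _ => True) * (-X : ℤ⟦X⟧) ^ triN s) =
      ∑ π : Nat.Partition n, if s < mex π then (-1 : ℤ) ^ triN s else 0 := by
    intro s
    have hs : ((Finset.univ : Finset (Nat.Partition n)).filter (fun π => s < mex π)).card =
        if triN s ≤ n then (Nat.Partition.restricted (n - triN s) (fun _ => True)).card else 0 := by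
      rw [← card_contains]
      congr 1
      ext π
      simp only [Finset.mem_filter, Finset.mem_univ, true_and, lt_mex_iff]
    rw [← Finset.sum_filter, Finset.sum_const, hs, neg_pow,
      show gfR (fun _ => True) * ((-1 : ℤ⟦X⟧) ^ triN s * X ^ triN s) =
        (-1 : ℤ⟦X⟧) ^ triN s * (gfR (fun _ => True) * X ^ triN s) by ring]
    rw [show (-1 : ℤ⟦X⟧) ^ triN s = C ((-1 : ℤ) ^ triN s) by simp, coeff_C_mul, coeff_mul_X_pow']
    simp only [gfR, coeff_mk]
    split_ifs <;> simp [mul_comm]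
  simp only [k4]
  rw [Finset.sum_comm]
  have k5 : ∀ π : Nat.Partition n,
      ∑ s ∈ Finset.range (2 * (n + 1)), (if s < mex π then (-1 : ℤ) ^ triN s else 0) =
      (if mex π % 4 = 1 then 1 else 0) - (if mex π % 4 = 3 then 1 else 0) := by
    intro π
    rw [← sum_sign, ← Finset.sum_filter]
    refine Finset.sum_congr ?_ fun _ _ => rfl
    ext s
    have := mex_le π (n + 1) (by omega)
      (fun h => by have := Nat.Partition.le_of_mem_parts h; omega)
    simp only [Finset.mem_filter, Finset.mem_range]
    omega
  simp only [k5, Finset.sum_sub_distrib]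
  simp

theorem restr_two_odd (n : ℕ) (h : Odd n) :
    (Nat.Partition.restricted n (fun i => i % 4 = 2)).card = 0 := by
  rw [Finset.card_eq_zero, Nat.Partition.restricted, Finset.filter_eq_empty_iff]
  intro π _ hπ
  have : 2 ∣ π.parts.sum := Multiset.dvd_sum fun i hi => by have := hπ i hi; omega
  rw [π.parts_sum] at this
  rw [← even_iff_two_dvd] at this
  exact (Nat.not_even_iff_odd.2 h) this

theorem restr_two_even (m : ℕ) :
    (Nat.Partition.restricted (2 * m) (fun i => i % 4 = 2)).card = qdist m := by
  rw [qdist, ← Nat.Partition.card_odds_eq_card_distincts]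
  symm
  refine Finset.card_bij (fun π _ => ⟨π.parts.map (2 * ·), ?_, ?_⟩) ?_ ?_ ?_
  · intro i hi
    obtain ⟨j, hj, rfl⟩ := Multiset.mem_map.1 hi
    have := π.parts_pos hj
    omega
  · rw [Multiset.sum_map_mul_left, Multiset.map_id', π.parts_sum]
  · intro π hπ
    simp only [Nat.Partition.odds, Nat.Partition.restricted, Finset.mem_filter, Finset.mem_univ,
      true_and] at hπ ⊢
    intro i hi
    obtain ⟨j, hj, rfl⟩ := Multiset.mem_map.1 hi
    have := hπ j hj
    rw [Nat.even_iff] at this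
    omega
  · intro π _ σ _ h
    rw [Nat.Partition.mk.injEq] at h
    exact Nat.Partition.ext (Multiset.map_injective (fun a b h => by simpa using h) h)
  · intro π hπ
    simp only [Nat.Partition.restricted, Finset.mem_filter, Finset.mem_univ,
      true_and] at hπ
    have e : (π.parts.map (· / 2)).map (2 * ·) = π.parts := by
      rw [Multiset.map_map]
      conv_rhs => rw [← Multiset.map_id π.parts]
      refine Multiset.map_congr rfl fun i hi => ?_
      have := hπ i hi
      simp only [Function.comp, id]
      omega
    refine ⟨⟨π.parts.map (· / 2), ?_, ?_⟩, ?_, ?_⟩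
    · intro i hi
      obtain ⟨j, hj, rfl⟩ := Multiset.mem_map.1 hi
      have := hπ j hj
      omega
    · have := π.parts_sum
      rw [← e, Multiset.sum_map_mul_left, Multiset.map_id'] at this
      omega
    · simp only [Nat.Partition.odds, Nat.Partition.restricted, Finset.mem_filter, Finset.mem_univ,
        true_and]
      intro i hi
      obtain ⟨j, hj, rfl⟩ := Multiset.mem_map.1 hi
      have := hπ j hj
      rw [Nat.even_iff]
      omega
    · exact Nat.Partition.ext e

theorem o1_eq_o3 (n : ℕ) (hn : 0 < n) :
    (Odd n →
      (Finset.univ.filter (fun π : Nat.Partition n => mex π % 4 = 1)).card =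
        (Finset.univ.filter (fun π : Nat.Partition n => mex π % 4 = 3)).card) ∧
    (Even n →
      (Finset.univ.filter (fun π : Nat.Partition n => mex π % 4 = 1)).card =
        (Finset.univ.filter (fun π : Nat.Partition n => mex π % 4 = 3)).card +
          qdist (n / 2)) := by
  have h := o1_sub_o3 n
  constructor
  · intro ho
    rw [restr_two_odd n ho] at h
    omega
  · intro he
    have e := restr_two_even (n / 2)
    rw [Nat.two_mul_div_two_of_even he] at e
    rw [e] at h
    omega
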